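/- arXiv:2010.11770 — 3 statements merged into one kernel-verified Lean document; each statement's English description precedes it below -/
import Mathlib

section
/- For every base b > 1 and every k ∈ ℕ, the function x ↦ 4^{log*_b(x)} is eventually dominated by the k-fold iterated natural logarithm: 4^{log*_b(x)} ≤ log^{(k)}(x) for all sufficiently large x. -/
/-- The `k`-fold iterated base-`b` logarithm. -/
noncomputable def iterLogb (b : ℝ) : ℕ → ℝ → ℝ
  | 0 => id
  | (k + 1) => fun x => Real.logb b (iterLogb b k x)

/-- The base-`b` iterated logarithm `log*_b`. -/
noncomputable def logStar (b : ℝ) (x : ℝ) : ℕ := sInf {k : ℕ | iterLogb b k x ≤ 1}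

/-- The `k`-fold iterated natural logarithm. -/
noncomputable def iterLog : ℕ → ℝ → ℝ
  | 0 => id
  | (k + 1) => fun x => Real.log (iterLog k x)

theorem aux_tendsto_iterLog (k : ℕ) : Filter.Tendsto (iterLog k) Filter.atTop Filter.atTop := by
  induction k with
  | zero => exact Filter.tendsto_id
  | succ k ih => exact Real.tendsto_log_atTop.comp ih

theorem aux_tendsto_iterLogb (b : ℝ) (hb : 1 < b) (k : ℕ) :
    Filter.Tendsto (iterLogb b k) Filter.atTop Filter.atTop := by
  induction k with
  | zero => exact Filter.tendsto_id
  | succ k ih => exact (Real.tendsto_logb_atTop hb).comp ih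

theorem aux_compare (b : ℝ) (hb : 1 < b) (k : ℕ) :
    ∃ K : ℝ, 0 < K ∧ ∀ᶠ x in Filter.atTop, iterLogb b k x ≤ K * iterLog k x := by
  have hlb : 0 < Real.log b := Real.log_pos hb
  induction k with
  | zero => exact ⟨1, one_pos, Filter.Eventually.of_forall fun x => by simp [iterLogb, iterLog]⟩
  | succ k ih =>
    obtain ⟨K, hK, h⟩ := ih
    refine ⟨2 / Real.log b, by positivity, ?_⟩
    filter_upwards [h, (aux_tendsto_iterLogb b hb k).eventually_gt_atTop 0,
      (aux_tendsto_iterLog k).eventually_gt_atTop 0,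
      (aux_tendsto_iterLog (k + 1)).eventually_ge_atTop (Real.log K)] with x h1 h2 h3 h4
    have h5 : Real.log (iterLogb b k x) ≤ Real.log K + Real.log (iterLog k x) := by
      rw [← Real.log_mul hK.ne' h3.ne']
      exact Real.log_le_log h2 h1
    change Real.log K ≤ Real.log (iterLog k x) at h4
    change Real.log (iterLogb b k x) / Real.log b ≤ 2 / Real.log b * Real.log (iterLog k x)
    rw [div_mul_eq_mul_div]
    gcongr
    linarith

theorem aux_small (b : ℝ) (hb : 1 < b) (h : Real.exp 1 * Real.log b ≤ 1) (x : ℝ)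
    (hx : Real.exp 1 ≤ x) (n : ℕ) : Real.exp 1 ≤ iterLogb b n x := by
  have hlb : 0 < Real.log b := Real.log_pos hb
  induction n with
  | zero => exact hx
  | succ n ih =>
    change Real.exp 1 ≤ Real.log (iterLogb b n x) / Real.log b
    have h1 : 1 ≤ Real.log (iterLogb b n x) := by
      rw [Real.le_log_iff_exp_le (lt_of_lt_of_le (Real.exp_pos 1) ih)]
      exact ih
    rw [le_div_iff₀ hlb]
    linarith

theorem aux_step (b : ℝ) (hb : 1 < b) (y : ℝ) (hy : 1 < y) (hy' : 1 < Real.logb b y) :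
    Real.log (Real.logb b y) ≤ Real.log y - (1 + Real.log (Real.log b)) := by
  have hlb : 0 < Real.log b := Real.log_pos hb
  have hly : 0 < Real.log y := Real.log_pos hy
  have h1 : Real.log (Real.log y) ≤ Real.log y - 1 := Real.log_le_sub_one_of_pos hly
  unfold Real.logb
  rw [Real.log_div hly.ne' hlb.ne']
  linarith

theorem aux_desc (b : ℝ) (hb : 1 < b) (x : ℝ) (n j : ℕ) (m : ℕ)
    (h : ∀ i < n, 1 < iterLogb b i x) (hm : j + m < n) :
    Real.log (iterLogb b (j + m) x) ≤
      Real.log (iterLogb b j x) - m * (1 + Real.log (Real.log b)) := by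
  induction m with
  | zero => simp
  | succ m ih =>
    have h1 := ih (by omega)
    have h2 := aux_step b hb (iterLogb b (j + m) x) (h _ (by omega)) (h (j + m + 1) hm)
    change Real.log (Real.logb b (iterLogb b (j + m) x)) ≤ _
    push_cast
    linarith

theorem four_pow_logStar_eventually_le_iterLog (b : ℝ) (hb : 1 < b) (k : ℕ) :
    ∀ᶠ x in Filter.atTop, (4 : ℝ) ^ (logStar b x) ≤ iterLog k x := by
  by_cases hc : Real.exp 1 * Real.log b ≤ 1
  · filter_upwards [Filter.eventually_ge_atTop (Real.exp 1),
      (aux_tendsto_iterLog k).eventually_ge_atTop 1] with x hx hx1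
    have he : {n : ℕ | iterLogb b n x ≤ 1} = ∅ := by
      ext n
      simp only [Set.mem_setOf_eq, Set.mem_empty_iff_false, iff_false, not_le]
      have := aux_small b hb hc x hx n
      have h2 := Real.add_one_lt_exp (one_ne_zero)
      linarith
    simp [logStar, he, hx1]
  push Not at hc
  have hlb : 0 < Real.log b := Real.log_pos hb
  have hd : 0 < 1 + Real.log (Real.log b) := by
    have := Real.log_pos hc
    rwa [Real.log_mul (Real.exp_pos 1).ne' hlb.ne', Real.log_exp] at this
  obtain ⟨D, hD⟩ := exists_nat_ge (Real.log 4 / (1 + Real.log (Real.log b)))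
  obtain ⟨K, hK, hcomp⟩ := aux_compare b hb (k + 1)
  have hlim : ∀ᶠ z : ℝ in Filter.atTop, 4 ^ (k + 2) * (K * Real.log z) ^ D ≤ z := by
    have hpos : (0 : ℝ) < 1 / (4 ^ (k + 2) * K ^ D) := by positivity
    have := (Real.isLittleO_pow_log_id_atTop (n := D)).def hpos
    filter_upwards [this, Filter.eventually_ge_atTop 1] with z hz hz1
    have hl := Real.log_nonneg hz1
    rw [Real.norm_of_nonneg (by positivity), id, Real.norm_of_nonneg (by positivity),
      one_div_mul_eq_div, le_div_iff₀ (by positivity)] at hz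
    rw [mul_pow]
    linarith
  filter_upwards [(aux_tendsto_iterLog k).eventually hlim, hcomp,
    (aux_tendsto_iterLogb b hb (k + 1)).eventually_gt_atTop 1,
    (aux_tendsto_iterLog k).eventually_ge_atTop 1] with x h1 h2 h3 h4
  set n := logStar b x with hn
  have hlt : ∀ i < n, 1 < iterLogb b i x := by
    intro i hi
    have := Nat.notMem_of_lt_sInf hi
    simpa using this
  set y := iterLogb b (k + 1) x with hy
  have hly : 0 < Real.log y := Real.log_pos h3
  have hl4 : 0 < Real.log 4 := Real.log_pos (by norm_num)
  have hnb : (n : ℝ) * Real.log 4 ≤ ((k + 2 : ℕ) : ℝ) * Real.log 4 + D * Real.log y := by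
    rcases Nat.lt_or_ge (k + 1) n with hkn | hkn
    · obtain ⟨m, hmn⟩ : ∃ m, n = k + 1 + m + 1 := ⟨n - (k + 2), by omega⟩
      have h5 := aux_desc b hb x _ (k + 1) m hlt (by omega)
      have h6 := Real.log_pos (hlt (k + 1 + m) (by omega))
      rw [← hy] at h5
      rw [div_le_iff₀ hd] at hD
      have h7 : (m : ℝ) * Real.log 4 ≤ D * Real.log y := by
        calc (m : ℝ) * Real.log 4 ≤ m * (D * (1 + Real.log (Real.log b))) := by gcongr
          _ = D * (m * (1 + Real.log (Real.log b))) := by ring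
          _ ≤ D * Real.log y := by gcongr; linarith
      rw [hmn]
      push_cast
      linarith
    · have : (n : ℝ) ≤ ((k + 2 : ℕ) : ℝ) := by exact_mod_cast (by omega)
      have h8 : (0 : ℝ) ≤ D * Real.log y := by positivity
      nlinarith
  have hfin : (4 : ℝ) ^ n ≤ 4 ^ (k + 2) * y ^ D := by
    have hy0 : 0 < y := by linarith
    rw [← Real.log_le_log_iff (by positivity) (by positivity), Real.log_mul (by positivity)
      (by positivity), Real.log_pow, Real.log_pow, Real.log_pow]
    exact hnb
  refine hfin.trans (le_trans ?_ h1)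
  have hy0 : 0 ≤ y := by linarith
  gcongr
  exact h2
end

section
/- Let u : ℝ² → ℝ be continuous and suppose there exist paths: γ₁ in [0,R]² from {0}×[0,R] to {R}×[a,b]; γ₂ in [R−Q,R]×[0,R] from {R−Q}×[0,a] to [R−Q,R]×{R}; γ₃ in [R−Q,R]×[0,R] from [R−Q,R]×{R} to {R}×[0,a]; and γ₄ in [R−Q,2R−Q]×[0,R] from {R−Q}×[a,b] to {2R−Q}×[0,R], where 0 ≤ Q ≤ R and 0 ≤ a ≤ b ≤ R. If γ₁ and γ₂ are disjoint, then γ₁ ∪ γ₃ contains a path in [R−Q,R]×[0,R] from {R−Q}×[0,a] to [R−Q,R]×{R}, and hence γ₁ ∪ γ₃ intersects γ₄. -/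
open Set

lemma aux_stay (g : ℝ → ℝ) (hg : Continuous g) (m : ℝ) (hc : ∀ t, 0 ≤ Real.cos (g t - m))
    (t₀ : ℝ) (h0 : |g t₀ - m| ≤ Real.pi / 2) (t : ℝ) : |g t - m| ≤ Real.pi / 2 := by
  by_contra! hlt
  have hpi := Real.pi_pos
  have hcont : Continuous fun t => |g t - m| := by fun_prop
  have hv : min (|g t - m|) Real.pi ∈ range fun t => |g t - m| :=
    mem_range_of_exists_le_of_exists_ge hcont
      ⟨t₀, h0.trans (le_min hlt.le (by linarith))⟩ ⟨t, min_le_left _ _⟩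
  obtain ⟨t', ht'⟩ := hv
  have h1 : Real.cos (|g t' - m|) < 0 := by
    have ht'' : |g t' - m| = min (|g t - m|) Real.pi := ht'
    rw [ht'']
    apply Real.cos_neg_of_pi_div_two_lt_of_lt
    · exact lt_min hlt (by linarith)
    · linarith [min_le_right (|g t - m|) Real.pi]
  rw [Real.cos_abs] at h1
  linarith [hc t']

lemma aux_cross' (α β : ℝ → ℝ × ℝ) (hα : Continuous α) (hβ : Continuous β) (c : ℝ)
    (h1 : ∀ t, c ≤ (α t).1) (h2 : ∀ t, (α t).1 ≤ (β 1).1)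
    (h3 : ∀ t, c ≤ (β t).1) (h4 : ∀ t, (β t).2 ≤ (α 1).2)
    (hα0 : (α 0).1 = c) (hβ0 : (β 0).1 = c) (hle : (α 0).2 ≤ (β 0).2) :
    ∃ s t, α s = β t := by
  by_contra! hne
  let F : C(ℝ × ℝ, ℂ) := ⟨fun p => ((α p.1).1 - (β p.2).1 : ℝ) +
    ((α p.1).2 - (β p.2).2 : ℝ) * Complex.I, by fun_prop⟩
  have Fre : ∀ s t, (F (s, t)).re = (α s).1 - (β t).1 := by intro s t; simp [F]
  have Fim : ∀ s t, (F (s, t)).im = (α s).2 - (β t).2 := by intro s t; simp [F]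
  have hF0 : ∀ p, F p ∈ ({0}ᶜ : Set ℂ) := by
    rintro ⟨s, t⟩ h0
    have h0 : F (s, t) = 0 := h0
    apply hne s t
    have e1 := Fre s t
    have e2 := Fim s t
    rw [h0] at e1 e2
    simp only [Complex.zero_re, Complex.zero_im] at e1 e2
    exact Prod.ext (by linarith) (by linarith)
  obtain ⟨G, ⟨hG0, hG⟩, -⟩ := Complex.isCoveringMapOn_exp.existsUnique_continuousMap_lifts F
    (a₀ := (0, 0)) (e₀ := Complex.log (F (0, 0))) (Complex.exp_log (hF0 _)) hF0
  have hG' : ∀ p, Complex.exp (G p) = F p := fun p => congrFun hG p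
  let θ : ℝ → ℝ → ℝ := fun s t => (G (s, t)).im
  have re' : ∀ s t, Real.exp (G (s, t)).re * Real.cos (θ s t) = (α s).1 - (β t).1 := by
    intro s t; rw [← Fre, ← hG', Complex.exp_re]
  have im' : ∀ s t, Real.exp (G (s, t)).re * Real.sin (θ s t) = (α s).2 - (β t).2 := by
    intro s t; rw [← Fim, ← hG', Complex.exp_im]
  have hpi := Real.pi_pos
  have θ0 : θ 0 0 = -(Real.pi / 2) := by
    have hre : (F (0, 0)).re = 0 := by rw [Fre, hα0, hβ0, sub_self]
    have him : (F (0, 0)).im < 0 := by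
      have : (F (0, 0)).im ≤ 0 := by rw [Fim]; linarith
      refine lt_of_le_of_ne this fun h => hF0 (0, 0) ?_
      exact Complex.ext hre h
    change (G (0, 0)).im = _
    rw [hG0, Complex.log_im, Complex.arg_eq_neg_pi_div_two_iff.2 ⟨hre, him⟩]
  have cosnp : ∀ s t, (α s).1 - (β t).1 ≤ 0 → Real.cos (θ s t) ≤ 0 := by
    intro s t h; rw [← re'] at h
    exact nonpos_of_mul_nonpos_right h (Real.exp_pos _)
  have cosnn : ∀ s t, 0 ≤ (α s).1 - (β t).1 → 0 ≤ Real.cos (θ s t) := by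
    intro s t h; rw [← re'] at h
    exact nonneg_of_mul_nonneg_right h (Real.exp_pos _)
  have sinnn : ∀ s t, 0 ≤ (α s).2 - (β t).2 → 0 ≤ Real.sin (θ s t) := by
    intro s t h; rw [← im'] at h
    exact nonneg_of_mul_nonneg_right h (Real.exp_pos _)
  have θc1 : ∀ s, Continuous fun t => θ s t := by intro s; simp only [θ]; fun_prop
  have θc2 : ∀ t, Continuous fun s => θ s t := by intro t; simp only [θ]; fun_prop
  have a1 := aux_stay (fun t => θ 0 t) (θc1 0) (-Real.pi) (fun t => by
    rw [sub_neg_eq_add, Real.cos_add_pi]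
    have := cosnp 0 t (by linarith [h3 t]); linarith) 0
    (by simp only [θ0]; rw [abs_le]; constructor <;> linarith) 1
  have a2 := aux_stay (fun s => θ s 1) (θc2 1) (-Real.pi) (fun s => by
    rw [sub_neg_eq_add, Real.cos_add_pi]
    have := cosnp s 1 (by linarith [h2 s]); linarith) 0 a1 1
  have b2 : θ 1 1 ≤ -Real.pi := by
    by_contra! h
    have := sinnn 1 1 (by linarith [h4 1])
    rw [abs_le] at a2
    have := Real.sin_neg_of_neg_of_neg_pi_lt (x := θ 1 1) (by linarith [a2.2]) h
    linarith
  rw [abs_le] at a2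
  have a3 := aux_stay (fun t => θ 1 t) (θc1 1) (-(3 * Real.pi / 2)) (fun t => by
    have e : θ 1 t - -(3 * Real.pi / 2) = (θ 1 t - Real.pi / 2) + 2 * Real.pi := by ring
    simp only [e]
    rw [Real.cos_add_two_pi, Real.cos_sub_pi_div_two]
    exact sinnn 1 t (by linarith [h4 t])) 1
    (by rw [abs_le]; constructor <;> linarith [a2.1]) 0
  rw [abs_le] at a3
  have b3 : θ 1 0 ≤ -(3 * Real.pi / 2) := by
    by_contra! h
    have := cosnn 1 0 (by linarith [h1 1])
    have := Real.cos_neg_of_pi_div_two_lt_of_lt (x := θ 1 0 + 2 * Real.pi)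
      (by linarith) (by linarith [a3.2])
    rw [Real.cos_add_two_pi] at this
    linarith
  have a4 := aux_stay (fun s => θ s 0) (θc2 0) (-(2 * Real.pi)) (fun s => by
    rw [sub_neg_eq_add, Real.cos_add_two_pi]
    exact cosnn s 0 (by linarith [h1 s])) 1
    (by rw [abs_le]; constructor <;> linarith [a3.1]) 0
  simp only [θ0] at a4
  rw [abs_le] at a4
  linarith [a4.2]

lemma aux_ext (γ : ℝ → ℝ × ℝ) (h : ContinuousOn γ (Icc 0 1)) :
    ∃ g : ℝ → ℝ × ℝ, Continuous g ∧ (∀ t ∈ Icc (0:ℝ) 1, g t = γ t) ∧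
      ∀ t, ∃ s ∈ Icc (0:ℝ) 1, g t = γ s := by
  refine ⟨IccExtend zero_le_one ((Icc 0 1).domRestrict γ), h.domRestrict.Icc_extend', ?_, ?_⟩
  · intro t ht
    rw [IccExtend_of_mem _ _ ht]; rfl
  · intro t
    exact ⟨projIcc 0 1 zero_le_one t, (projIcc 0 1 zero_le_one t).2, rfl⟩

lemma aux_cross (α β : ℝ → ℝ × ℝ) (hα : ContinuousOn α (Icc 0 1))
    (hβ : ContinuousOn β (Icc 0 1)) (c : ℝ)
    (h1 : ∀ t ∈ Icc (0:ℝ) 1, c ≤ (α t).1) (h2 : ∀ t ∈ Icc (0:ℝ) 1, (α t).1 ≤ (β 1).1)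
    (h3 : ∀ t ∈ Icc (0:ℝ) 1, c ≤ (β t).1) (h4 : ∀ t ∈ Icc (0:ℝ) 1, (β t).2 ≤ (α 1).2)
    (hα0 : (α 0).1 = c) (hβ0 : (β 0).1 = c) (hle : (α 0).2 ≤ (β 0).2) :
    ∃ s ∈ Icc (0:ℝ) 1, ∃ t ∈ Icc (0:ℝ) 1, α s = β t := by
  obtain ⟨a, ha, ha', ha''⟩ := aux_ext α hα
  obtain ⟨b, hb, hb', hb''⟩ := aux_ext β hβ
  have i0 : (0:ℝ) ∈ Icc (0:ℝ) 1 := by simp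
  have i1 : (1:ℝ) ∈ Icc (0:ℝ) 1 := by simp
  obtain ⟨s, t, hst⟩ := aux_cross' a b ha hb c
    (fun t => by obtain ⟨s, hs, e⟩ := ha'' t; rw [e]; exact h1 s hs)
    (fun t => by obtain ⟨s, hs, e⟩ := ha'' t; rw [e, hb' 1 i1]; exact h2 s hs)
    (fun t => by obtain ⟨s, hs, e⟩ := hb'' t; rw [e]; exact h3 s hs)
    (fun t => by obtain ⟨s, hs, e⟩ := hb'' t; rw [e, ha' 1 i1]; exact h4 s hs)
    (by rw [ha' 0 i0, hα0]) (by rw [hb' 0 i0, hβ0]) (by rw [ha' 0 i0, hb' 0 i0]; exact hle)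
  obtain ⟨s', hs', es⟩ := ha'' s
  obtain ⟨t', ht', et⟩ := hb'' t
  exact ⟨s', hs', t', ht', by rw [← es, ← et, hst]⟩

lemma aux_last (f : ℝ → ℝ) (hf : ContinuousOn f (Icc 0 1)) (c : ℝ) (h0 : f 0 ≤ c)
    (h1 : c ≤ f 1) : ∃ τ ∈ Icc (0:ℝ) 1, f τ = c ∧ ∀ t ∈ Icc τ 1, c ≤ f t := by
  have hK : IsCompact (Icc (0:ℝ) 1 ∩ f ⁻¹' Iic c) :=
    isCompact_Icc.of_isClosed_subset (hf.preimage_isClosed_of_isClosed isClosed_Icc isClosed_Iic)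
      inter_subset_left
  obtain ⟨τ, ⟨hτ, hτc⟩, hmax⟩ := hK.exists_isGreatest ⟨0, by simp, h0⟩
  have hτc : f τ ≤ c := hτc
  have key : ∀ t ∈ Icc τ 1, f t ≤ c → t = τ := fun t ht h =>
    le_antisymm (hmax ⟨⟨hτ.1.trans ht.1, ht.2⟩, h⟩) ht.1
  have hfτ : f τ = c := by
    obtain ⟨t, ht, htc⟩ := intermediate_value_Icc hτ.2
      (hf.mono (Icc_subset_Icc hτ.1 le_rfl)) (show c ∈ Icc (f τ) (f 1) from ⟨hτc, h1⟩)
    rw [← key t ht htc.le]; exact htc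
  refine ⟨τ, hτ, hfτ, fun t ht => ?_⟩
  by_contra! h
  have := key t ht h.le
  subst this
  linarith

theorem cross_X_cross_topological_core
    (R Q a b : ℝ) (hQ0 : 0 ≤ Q) (hQR : Q ≤ R)
    (ha : 0 ≤ a) (hab : a ≤ b) (hbR : b ≤ R)
    (u : ℝ × ℝ → ℝ) (hu : Continuous u)
    (γ₁ γ₂ γ₃ γ₄ : ℝ → ℝ × ℝ)
    (h₁cont : ContinuousOn γ₁ (Icc 0 1))
    (h₂cont : ContinuousOn γ₂ (Icc 0 1))
    (h₃cont : ContinuousOn γ₃ (Icc 0 1))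
    (h₄cont : ContinuousOn γ₄ (Icc 0 1))
    (h₁range : ∀ t ∈ Icc (0:ℝ) 1, γ₁ t ∈ Icc (0:ℝ) R ×ˢ Icc (0:ℝ) R)
    (h₂range : ∀ t ∈ Icc (0:ℝ) 1, γ₂ t ∈ Icc (R - Q) R ×ˢ Icc (0:ℝ) R)
    (h₃range : ∀ t ∈ Icc (0:ℝ) 1, γ₃ t ∈ Icc (R - Q) R ×ˢ Icc (0:ℝ) R)
    (h₄range : ∀ t ∈ Icc (0:ℝ) 1, γ₄ t ∈ Icc (R - Q) (2 * R - Q) ×ˢ Icc (0:ℝ) R)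
    (h₁0 : (γ₁ 0).1 = 0 ∧ (γ₁ 0).2 ∈ Icc (0:ℝ) R)
    (h₁1 : (γ₁ 1).1 = R ∧ (γ₁ 1).2 ∈ Icc a b)
    (h₂0 : (γ₂ 0).1 = R - Q ∧ (γ₂ 0).2 ∈ Icc (0:ℝ) a)
    (h₂1 : (γ₂ 1).1 ∈ Icc (R - Q) R ∧ (γ₂ 1).2 = R)
    (h₃0 : (γ₃ 0).1 ∈ Icc (R - Q) R ∧ (γ₃ 0).2 = R)
    (h₃1 : (γ₃ 1).1 = R ∧ (γ₃ 1).2 ∈ Icc (0:ℝ) a)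
    (h₄0 : (γ₄ 0).1 = R - Q ∧ (γ₄ 0).2 ∈ Icc a b)
    (h₄1 : (γ₄ 1).1 = 2 * R - Q ∧ (γ₄ 1).2 ∈ Icc (0:ℝ) R)
    (hdisj : Disjoint (γ₁ '' Icc 0 1) (γ₂ '' Icc 0 1)) :
    (∃ γ : ℝ → ℝ × ℝ, ContinuousOn γ (Icc 0 1) ∧
      (∀ t ∈ Icc (0:ℝ) 1,
        γ t ∈ (γ₁ '' Icc 0 1 ∪ γ₃ '' Icc 0 1) ∩ (Icc (R - Q) R ×ˢ Icc (0:ℝ) R)) ∧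
      ((γ 0).1 = R - Q ∧ (γ 0).2 ∈ Icc (0:ℝ) a) ∧
      ((γ 1).1 ∈ Icc (R - Q) R ∧ (γ 1).2 = R)) ∧
    ((γ₁ '' Icc 0 1 ∪ γ₃ '' Icc 0 1) ∩ γ₄ '' Icc 0 1).Nonempty := by
  have i0 : (0:ℝ) ∈ Icc (0:ℝ) 1 := by simp
  have i1 : (1:ℝ) ∈ Icc (0:ℝ) 1 := by simp
  have first : ∃ γ : ℝ → ℝ × ℝ, ContinuousOn γ (Icc 0 1) ∧
      (∀ t ∈ Icc (0:ℝ) 1,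
        γ t ∈ (γ₁ '' Icc 0 1 ∪ γ₃ '' Icc 0 1) ∩ (Icc (R - Q) R ×ˢ Icc (0:ℝ) R)) ∧
      ((γ 0).1 = R - Q ∧ (γ 0).2 ∈ Icc (0:ℝ) a) ∧
      ((γ 1).1 ∈ Icc (R - Q) R ∧ (γ 1).2 = R) := by
    obtain ⟨τ, hτ, hτc, hlast⟩ := aux_last (fun t => (γ₁ t).1)
      (continuous_fst.comp_continuousOn h₁cont) (R - Q) (by simp only [h₁0.1]; linarith)
      (by simp only [h₁1.1]; linarith)
    have hseg : ∀ t ∈ Icc (0:ℝ) 1, τ + (1 - τ) * t ∈ Icc τ 1 := fun t ht =>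
      ⟨by nlinarith [hτ.1, hτ.2, ht.1, ht.2], by nlinarith [hτ.1, hτ.2, ht.1, ht.2]⟩
    have hsub : Icc τ 1 ⊆ Icc (0:ℝ) 1 := Icc_subset_Icc hτ.1 le_rfl
    have hδ : ContinuousOn (fun t => γ₁ (τ + (1 - τ) * t)) (Icc 0 1) :=
      h₁cont.comp (by fun_prop) fun t ht => hsub (hseg t ht)
    have hlow : (γ₁ τ).2 ≤ a := by
      by_contra! h
      obtain ⟨s, hs, t, ht, e⟩ := aux_cross γ₂ (fun t => γ₁ (τ + (1 - τ) * t)) h₂cont hδ (R - Q)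
        (fun t ht => (h₂range t ht).1.1)
        (fun t ht => by
          have := (h₂range t ht).1.2
          simpa [h₁1.1] using this)
        (fun t ht => hlast _ (hseg t ht))
        (fun t ht => by rw [h₂1.2]; exact (h₁range _ (hsub (hseg t ht))).2.2)
        h₂0.1 (by simpa using hτc) (by simpa using h₂0.2.2.trans h.le)
      exact Set.disjoint_left.1 hdisj ⟨_, hsub (hseg t ht), e.symm⟩ ⟨s, hs, rfl⟩
    have hrev : ∀ t ∈ Icc (0:ℝ) 1, 1 - t ∈ Icc (0:ℝ) 1 := fun t ht =>
      ⟨by linarith [ht.2], by linarith [ht.1]⟩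
    have hrevc : ∀ γ : ℝ → ℝ × ℝ, ContinuousOn γ (Icc 0 1) →
        ContinuousOn (fun t => ((-(γ (1 - t)).1, (γ (1 - t)).2) : ℝ × ℝ)) (Icc 0 1) := by
      intro γ h
      have : ContinuousOn (fun t => γ (1 - t)) (Icc 0 1) := h.comp (by fun_prop) hrev
      exact (continuous_fst.comp_continuousOn this).neg.prodMk (continuous_snd.comp_continuousOn this)
    obtain ⟨s, hs, t, ht, e⟩ := aux_cross (fun t => (-(γ₃ (1 - t)).1, (γ₃ (1 - t)).2))
      (fun t => (-(γ₁ (τ + (1 - τ) * (1 - t))).1, (γ₁ (τ + (1 - τ) * (1 - t))).2))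
      (hrevc _ h₃cont) (hrevc _ hδ) (-R)
      (fun t ht => by simpa using (h₃range _ (hrev t ht)).1.2)
      (fun t ht => by
        have := (h₃range _ (hrev t ht)).1.1
        simp only [sub_self, mul_zero, add_zero, hτc]; linarith)
      (fun t ht => by simpa using (h₁range _ (hsub (hseg _ (hrev t ht)))).1.2)
      (fun t ht => by
        simp only [sub_self, h₃0.2]
        exact (h₁range _ (hsub (hseg _ (hrev t ht)))).2.2)
      (by simp [h₃1.1]) (by simp [h₁1.1]) (by simpa using h₃1.2.2.trans h₁1.2.1)
    have e' : γ₃ (1 - s) = γ₁ (τ + (1 - τ) * (1 - t)) := by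
      simp only [Prod.mk.injEq, neg_inj] at e
      exact Prod.ext e.1 e.2
    have hs' := hrev s hs
    have ht' := hseg _ (hrev t ht)
    generalize 1 - s = s₀ at e' hs'
    generalize τ + (1 - τ) * (1 - t) = t₀ at e' ht'
    obtain ⟨g₁, g₁c, g₁e, -⟩ := aux_ext γ₁ h₁cont
    obtain ⟨g₃, g₃c, g₃e, -⟩ := aux_ext γ₃ h₃cont
    refine ⟨fun t => if t ≤ 1/2 then g₁ (τ + (2 * t) * (t₀ - τ)) else g₃ (s₀ * (2 - 2 * t)),
      ?_, ?_, ?_, ?_⟩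
    · apply Continuous.continuousOn
      refine Continuous.if_le (by fun_prop) (by fun_prop) (by fun_prop) (by fun_prop) ?_
      rintro x rfl
      have e1 : τ + (2 * (1/2)) * (t₀ - τ) = t₀ := by ring
      have e2 : s₀ * (2 - 2 * (1/2)) = s₀ := by ring
      rw [e1, e2, g₁e _ (hsub ht'), g₃e _ hs', e']
    · intro x hx
      by_cases h : x ≤ 1/2
      · simp only [h, if_true]
        have hm : τ + (2 * x) * (t₀ - τ) ∈ Icc τ 1 :=
          ⟨by nlinarith [hx.1, ht'.1], by nlinarith [hx.1, ht'.1, ht'.2]⟩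
        rw [g₁e _ (hsub hm)]
        exact ⟨Or.inl ⟨_, hsub hm, rfl⟩, ⟨hlast _ hm, (h₁range _ (hsub hm)).1.2⟩,
          (h₁range _ (hsub hm)).2⟩
      · simp only [h, if_false]
        push Not at h
        have hm : s₀ * (2 - 2 * x) ∈ Icc (0:ℝ) 1 :=
          ⟨mul_nonneg hs'.1 (by linarith [hx.2]),
            mul_le_one₀ hs'.2 (by linarith [hx.2]) (by linarith)⟩
        rw [g₃e _ hm]
        exact ⟨Or.inr ⟨_, hm, rfl⟩, h₃range _ hm⟩
    · have : g₁ τ = γ₁ τ := g₁e _ hτ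
      simp [this, hτc, hlow, (h₁range _ hτ).2.1]
    · have h12 : ¬ ((1:ℝ) ≤ 1/2) := by norm_num
      simp only [h12, if_false]
      have : s₀ * (2 - 2 * 1) = 0 := by ring
      rw [this, g₃e _ i0]
      exact h₃0
  refine ⟨first, ?_⟩
  obtain ⟨γ, hc, hr, h0, h1⟩ := first
  obtain ⟨s, hs, t, ht, e⟩ := aux_cross γ γ₄ hc h₄cont (R - Q)
    (fun t ht => (hr t ht).2.1.1)
    (fun t ht => by rw [h₄1.1]; linarith [(hr t ht).2.1.2])
    (fun t ht => (h₄range t ht).1.1)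
    (fun t ht => by rw [h1.2]; exact (h₄range t ht).2.2)
    h0.1 h₄0.1 (h0.2.2.trans h₄0.2.1)
  exact ⟨γ s, (hr s hs).1, t, ht, e.symm⟩
end

section
/- Let u be a C² function on the closed disc B(0,R) ⊂ ℝ² that is a perfect Morse function for the stratification {interior, boundary circle} (distinct critical values at distinct stratified critical points, non-degenerate critical points on each stratum, no interior-critical behaviour on the boundary stratum). Then the number of 2R-saddle points of u in B(0,R) is at most max{0, N − 3}, where N is the number of critical points of the restriction of u to the boundary circle ∂B(0,R). A 2R-saddle point is a critical point x of u admitting four injective paths from x to ∂B(x,2R), pairwise intersecting only at x, on whose union u is constant. -/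
/-- The point on the circle of radius `R` at angle `θ`. -/
noncomputable def circlePt (R θ : ℝ) : EuclideanSpace ℝ (Fin 2) :=
  (WithLp.equiv 2 (Fin 2 → ℝ)).symm ![R * Real.cos θ, R * Real.sin θ]

open Real in
lemma side_aux (h : ℝ → ℝ) (hc : Continuous h) (hcos : ∀ t, 0 ≤ Real.cos (h t))
    (a b x y : ℝ) (n m : ℤ) (ha : h a = x + 2 * π * n) (hb : h b = y + 2 * π * m)
    (hx : |x| < π) (hy : |y| < π) : n = m := by
  have key : ∀ (a b x y : ℝ) (n m : ℤ), h a = x + 2 * π * n → h b = y + 2 * π * m →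
      |x| < π → |y| < π → ¬ n < m := by
    intro a b x y n m ha hb hx hy hnm
    rw [abs_lt] at hx hy
    have h1 : (n : ℝ) + 1 ≤ m := by exact_mod_cast hnm
    have h2 : h a ≤ π + 2 * π * n := by rw [ha]; linarith
    have h3 : π + 2 * π * n ≤ h b := by rw [hb]; nlinarith [Real.pi_pos]
    obtain ⟨t, ht⟩ := mem_range_of_exists_le_of_exists_ge hc ⟨a, h2⟩ ⟨b, h3⟩
    have h4 := hcos t
    rw [ht, show π + 2 * π * n = π + n * (2 * π) by ring, Real.cos_add_int_mul_two_pi,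
      Real.cos_pi] at h4
    linarith
  rcases lt_trichotomy n m with h | h | h
  · exact (key a b x y n m ha hb hx hy h).elim
  · exact h
  · exact (key b a y x m n hb ha hy hx h).elim

lemma side_cos (R α : ℝ) (w L : ℂ) (hw : ‖w‖ ≤ R)
    (h : Complex.exp L = R * Complex.exp (α * Complex.I) - w) : 0 ≤ Real.cos (L.im - α) := by
  have h1 : Complex.exp (L - α * Complex.I) = R - w * Complex.exp (-(α * Complex.I)) := by
    rw [sub_eq_add_neg, Complex.exp_add, h, sub_mul, mul_assoc, ← Complex.exp_add]
    simp
  have h2 := congrArg Complex.re h1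
  rw [Complex.exp_re] at h2
  simp only [Complex.sub_re, Complex.sub_im, Complex.mul_re, Complex.mul_im, Complex.ofReal_re,
    Complex.ofReal_im, Complex.I_re, Complex.I_im] at h2
  have h3 : ‖w * Complex.exp (-(α * Complex.I))‖ ≤ R := by
    rw [norm_mul, Complex.norm_exp]; simpa using hw
  have h4 := (Complex.re_le_norm _).trans h3
  simp only [Complex.mul_re] at h4
  simp only [mul_zero, zero_mul, sub_zero, mul_one, add_zero, zero_add] at h2
  by_contra hneg
  push Not at hneg
  have := mul_neg_of_pos_of_neg (Real.exp_pos L.re) hneg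
  linarith

lemma side_cos' (R β : ℝ) (w L : ℂ) (hw : ‖w‖ ≤ R)
    (h : Complex.exp L = w - R * Complex.exp (β * Complex.I)) :
    0 ≤ Real.cos (L.im - β - Real.pi) := by
  have := side_cos R β w (L - Real.pi * Complex.I) hw (by
    rw [sub_eq_add_neg, Complex.exp_add, h, Complex.exp_neg, Complex.exp_pi_mul_I]
    ring)
  simpa [sub_right_comm] using this

open Real in
lemma corner (R α β : ℝ) (hR : 0 < R) (h1 : β < α) (h2 : α < β + 2 * π) (L : ℂ)
    (h : Complex.exp L = R * Complex.exp (α * Complex.I) - R * Complex.exp (β * Complex.I)) :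
    ∃ n : ℤ, L.im = (α + β) / 2 + π / 2 + 2 * π * n := by
  have hs : 0 < Real.sin ((α - β) / 2) :=
    Real.sin_pos_of_pos_of_lt_pi (by linarith) (by linarith)
  have hr : 0 < 2 * R * Real.sin ((α - β) / 2) := by positivity
  have e : Complex.exp L = Complex.exp (Real.log (2 * R * Real.sin ((α - β) / 2)) +
      ((α + β) / 2 + π / 2 : ℝ) * Complex.I) := by
    rw [Complex.exp_add, ← Complex.ofReal_exp, Real.exp_log hr, h]
    have e1 : Real.cos ((α + β) / 2 + π / 2) = - Real.sin ((α + β) / 2) := Real.cos_add_pi_div_two _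
    have e2 : Real.sin ((α + β) / 2 + π / 2) = Real.cos ((α + β) / 2) := Real.sin_add_pi_div_two _
    have e3 := Real.cos_sub_cos α β
    have e4 := Real.sin_sub_sin α β
    simp only [Complex.exp_mul_I, ← Complex.ofReal_cos, ← Complex.ofReal_sin]
    rw [e1, e2]
    generalize Real.cos α = x1 at e3 e4 ⊢
    generalize Real.cos β = x2 at e3 e4 ⊢
    generalize Real.sin α = x3 at e3 e4 ⊢
    generalize Real.sin β = x4 at e3 e4 ⊢
    generalize Real.sin ((α + β) / 2) = x5 at e3 e4 ⊢
    generalize Real.cos ((α + β) / 2) = x6 at e3 e4 ⊢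
    generalize Real.sin ((α - β) / 2) = x7 at e3 e4 ⊢
    apply Complex.ext
    · simp
      linear_combination R * e3
    · simp
      linear_combination R * e4
  obtain ⟨n, hn⟩ := Complex.exp_eq_exp_iff_exists_int.1 e
  refine ⟨n, ?_⟩
  rw [hn]
  simp
  ring

open Real in
lemma crossing_complex (R : ℝ) (hR : 0 < R) (a1 b1 a2 b2 : ℝ) (h1 : a1 < b1) (h2 : b1 < a2)
    (h3 : a2 < b2) (h4 : b2 < a1 + 2 * π) (f g : ℝ → ℂ) (hf : Continuous f) (hg : Continuous g)
    (hfR : ∀ t, ‖f t‖ ≤ R) (hgR : ∀ t, ‖g t‖ ≤ R)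
    (f0 : f 0 = R * Complex.exp (a1 * Complex.I)) (f1 : f 1 = R * Complex.exp (a2 * Complex.I))
    (g0 : g 0 = R * Complex.exp (b1 * Complex.I)) (g1 : g 1 = R * Complex.exp (b2 * Complex.I)) :
    ∃ s t, f s = g t := by
  by_contra! hne
  have hF : ∀ p : ℝ × ℝ, f p.1 - g p.2 ≠ 0 := fun p => sub_ne_zero.2 (hne _ _)
  let F : C(ℝ × ℝ, {z : ℂ // z ≠ 0}) := ⟨fun p => ⟨f p.1 - g p.2, hF p⟩, by fun_prop⟩
  obtain ⟨L, ⟨-, hL⟩, -⟩ := Complex.isCoveringMap_exp.existsUnique_continuousMap_lifts F (0, 0)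
    (Complex.log (f 0 - g 0)) (by
      apply Subtype.ext
      exact Complex.exp_log (hF (0, 0)))
  have hL' : ∀ s t, Complex.exp (L (s, t)) = f s - g t := fun s t =>
    congrArg Subtype.val (congrFun hL (s, t))
  obtain ⟨n11, c11⟩ := corner R b1 a1 hR h1 (by linarith) (L (0, 0) - π * Complex.I) (by
    rw [sub_eq_add_neg, Complex.exp_add, hL', Complex.exp_neg, Complex.exp_pi_mul_I, f0, g0]; ring)
  obtain ⟨n12, c12⟩ := corner R b2 a1 hR (by linarith) h4 (L (0, 1) - π * Complex.I) (by
    rw [sub_eq_add_neg, Complex.exp_add, hL', Complex.exp_neg, Complex.exp_pi_mul_I, f0, g1]; ring)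
  obtain ⟨n22, c22⟩ := corner R b2 a2 hR (by linarith) (by linarith) (L (1, 1) - π * Complex.I) (by
    rw [sub_eq_add_neg, Complex.exp_add, hL', Complex.exp_neg, Complex.exp_pi_mul_I, f1, g1]; ring)
  obtain ⟨n21, c21⟩ := corner R a2 b1 hR (by linarith) (by linarith) (L (1, 0)) (by
    rw [hL', f1, g0])
  simp at c11 c12 c22
  have s1 : n11 + 1 = n12 + 1 := side_aux (fun t => (L (0, t)).im - a1) (by fun_prop)
    (fun t => side_cos R a1 (g t) _ (hgR t) (by rw [hL', f0])) 0 1 ((b1 - a1) / 2 - π / 2)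
    ((b2 - a1) / 2 - π / 2) _ _ (by push_cast; linarith) (by push_cast; linarith)
    (by rw [abs_lt]; constructor <;> linarith) (by rw [abs_lt]; constructor <;> linarith)
  have s2 : n12 = n22 := side_aux (fun t => (L (t, 1)).im - b2 - π) (by fun_prop)
    (fun t => side_cos' R b2 (f t) _ (hfR t) (by rw [hL', g1])) 0 1 ((a1 - b2) / 2 + π / 2)
    ((a2 - b2) / 2 + π / 2) _ _ (by push_cast; linarith) (by push_cast; linarith)
    (by rw [abs_lt]; constructor <;> linarith) (by rw [abs_lt]; constructor <;> linarith)
  have s3 : n22 + 1 = n21 := side_aux (fun t => (L (1, t)).im - a2) (by fun_prop)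
    (fun t => side_cos R a2 (g t) _ (hgR t) (by rw [hL', f1])) 1 0 ((b2 - a2) / 2 - π / 2)
    ((b1 - a2) / 2 + π / 2) _ _ (by push_cast; linarith) (by push_cast; linarith)
    (by rw [abs_lt]; constructor <;> linarith) (by rw [abs_lt]; constructor <;> linarith)
  have s4 : n21 = n11 := side_aux (fun t => (L (t, 0)).im - b1 - π) (by fun_prop)
    (fun t => side_cos' R b1 (f t) _ (hfR t) (by rw [hL', g0])) 1 0 ((a2 - b1) / 2 - π / 2)
    ((a1 - b1) / 2 + π / 2) _ _ (by push_cast; linarith) (by push_cast; linarith)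
    (by rw [abs_lt]; constructor <;> linarith) (by rw [abs_lt]; constructor <;> linarith)
  omega

lemma comb {ι : Type*} [DecidableEq ι] (p : ι → Fin 4 → ℝ) (hp : ∀ a, StrictMono (p a)) (k : ℕ) :
    ∀ (K : Finset ι) (C : Finset ℝ), K.card = k → 2 ≤ C.card →
    (∀ a ∈ K, ∀ b ∈ K, a ≠ b → ∀ i j, p a i ≠ p b j) →
    (∀ a ∈ K, ∀ b ∈ K, a ≠ b → ∀ i i' j j', p a i < p b j → p b j < p a i' → p a i' < p b j' →
      False) →
    (∀ a ∈ K, ∀ i j, p a i < p a j → ∃ c ∈ C, p a i < c ∧ c < p a j) →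
    (∀ a ∈ K, ∀ i j, p a i < p a j → ∃ c ∈ C, c < p a i ∨ p a j < c) →
    2 * k + 2 ≤ C.card := by
  induction k with
  | zero => intro K C _ h _ _ _ _; omega
  | succ k ih =>
    intro K C hK hC hdis hnc hin hout
    obtain ⟨a, ha, hmin⟩ := K.exists_min_image (fun a => p a 3 - p a 0)
      (Finset.card_pos.1 (by omega))
    have h01 : p a 0 < p a 1 := hp a (by decide)
    have h12 : p a 1 < p a 2 := hp a (by decide)
    have h23 : p a 2 < p a 3 := hp a (by decide)
    have hb : ∀ b ∈ K, b ≠ a → ∀ j, ¬ (p a 0 < p b j ∧ p b j < p a 3) := by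
      rintro b hbK hba j ⟨hj1, hj2⟩
      have H : ∀ j', p a 0 < p b j' ∧ p b j' < p a 3 := by
        intro j'
        constructor
        · by_contra hlt
          have := lt_of_le_of_ne (not_lt.1 hlt) (hdis b hbK a ha hba j' 0)
          exact hnc b hbK a ha hba j' j 0 3 this hj1 hj2
        · by_contra hlt
          have := lt_of_le_of_ne (not_lt.1 hlt) (hdis b hbK a ha hba j' 3).symm
          exact hnc a ha b hbK hba.symm 0 3 j j' hj1 hj2 this
      have := hmin b hbK
      have := (H 0).1
      have := (H 3).2
      linarith
    obtain ⟨c0, c0C, hc0, hc0'⟩ := hin a ha 0 1 h01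
    obtain ⟨c1, c1C, hc1, hc1'⟩ := hin a ha 1 2 h12
    obtain ⟨c2, c2C, hc2, hc2'⟩ := hin a ha 2 3 h23
    obtain ⟨d, dC, hd⟩ := hout a ha 0 3 (by linarith)
    let C' := (C.erase c1).erase c2 |>.filter (fun c => c = c0 ∨ ¬ (p a 0 < c ∧ c < p a 3))
    have mem' : ∀ c, c ∈ C' ↔ c ∈ C ∧ (c = c0 ∨ ¬ (p a 0 < c ∧ c < p a 3)) := by
      intro c
      simp only [C', Finset.mem_filter, Finset.mem_erase]
      constructor
      · rintro ⟨⟨-, -, h⟩, h'⟩; exact ⟨h, h'⟩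
      · rintro ⟨h, h'⟩
        refine ⟨⟨?_, ?_, h⟩, h'⟩
        · rintro rfl
          rcases h' with h' | h'
          · linarith
          · exact h' ⟨by linarith, by linarith⟩
        · rintro rfl
          rcases h' with h' | h'
          · linarith
          · exact h' ⟨by linarith, by linarith⟩
    have hcard : C'.card + 2 ≤ C.card := by
      have e1 := Finset.card_filter_le ((C.erase c1).erase c2)
        (fun c => c = c0 ∨ ¬ (p a 0 < c ∧ c < p a 3))
      have e2 := Finset.card_erase_add_one c1C
      have e3 := Finset.card_erase_add_one
        (Finset.mem_erase.2 ⟨(show c2 ≠ c1 by rintro rfl; linarith), c2C⟩)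
      change C'.card ≤ _ at e1
      omega
    have m0 : c0 ∈ C' := (mem' _).2 ⟨c0C, Or.inl rfl⟩
    have md : d ∈ C' := (mem' _).2 ⟨dC, Or.inr (by rintro ⟨_, _⟩; rcases hd with h | h <;> linarith)⟩
    have hC' : 2 ≤ C'.card := Finset.one_lt_card.2 ⟨c0, m0, d, md, by
      rintro rfl; rcases hd with h | h <;> linarith⟩
    have := ih (K.erase a) C' (by rw [Finset.card_erase_of_mem ha]; omega) hC'
      (fun x hx y hy => hdis x (Finset.mem_of_mem_erase hx) y (Finset.mem_of_mem_erase hy))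
      (fun x hx y hy => hnc x (Finset.mem_of_mem_erase hx) y (Finset.mem_of_mem_erase hy))
      (by
        intro b hbK i j hij
        have hbK' := Finset.mem_of_mem_erase hbK
        have hba := Finset.ne_of_mem_erase hbK
        obtain ⟨c, hc, hc1, hc2⟩ := hin b hbK' i j hij
        by_cases hcin : p a 0 < c ∧ c < p a 3
        · refine ⟨c0, m0, ?_, ?_⟩
          · by_contra hcon
            exact hb b hbK' hba i ⟨by linarith, by linarith⟩
          · by_contra hcon
            exact hb b hbK' hba j ⟨by linarith, by linarith⟩
        · exact ⟨c, (mem' _).2 ⟨hc, Or.inr hcin⟩, hc1, hc2⟩)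
      (by
        intro b hbK i j hij
        have hbK' := Finset.mem_of_mem_erase hbK
        have hba := Finset.ne_of_mem_erase hbK
        obtain ⟨c, hc, hcc⟩ := hout b hbK' i j hij
        by_cases hcin : p a 0 < c ∧ c < p a 3
        · refine ⟨c0, m0, ?_⟩
          rcases hcc with hcc | hcc
          · left
            by_contra hcon
            exact hb b hbK' hba i ⟨by linarith, by linarith⟩
          · right
            by_contra hcon
            exact hb b hbK' hba j ⟨by linarith, by linarith⟩
        · exact ⟨c, (mem' _).2 ⟨hc, Or.inr hcin⟩, hcc⟩)
    omega

abbrev E2 := EuclideanSpace ℝ (Fin 2)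

noncomputable def toC (y : E2) : ℂ := (y 0 : ℂ) + (y 1 : ℂ) * Complex.I

lemma toC_cont : Continuous toC := by unfold toC; fun_prop

lemma toC_norm (y : E2) : ‖toC y‖ = ‖y‖ := by
  rw [EuclideanSpace.norm_eq, toC, Complex.norm_add_mul_I]
  simp

lemma toC_inj (y z : E2) (h : toC y = toC z) : y = z := by
  have h0 := congrArg Complex.re h
  have h1 := congrArg Complex.im h
  simp [toC] at h0 h1
  ext i
  fin_cases i
  · exact h0
  · exact h1

lemma toC_circlePt (R θ : ℝ) : toC (circlePt R θ) = R * Complex.exp (θ * Complex.I) := by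
  rw [Complex.exp_mul_I]
  simp [toC, circlePt]
  ring

lemma circlePt_norm (R θ : ℝ) (hR : 0 < R) : ‖circlePt R θ‖ = R := by
  rw [← toC_norm, toC_circlePt, norm_mul, Complex.norm_exp_ofReal_mul_I]
  simp [abs_of_pos hR]

lemma circlePt_periodic (R θ : ℝ) : circlePt R (θ + 2 * Real.pi) = circlePt R θ := by
  simp [circlePt]

lemma circlePt_cont (R : ℝ) : Continuous (circlePt R) := by
  unfold circlePt
  refine (PiLp.continuous_toLp 2 _).comp ?_
  refine continuous_pi fun i => ?_
  fin_cases i <;> simp <;> fun_prop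

lemma exists_angle (R : ℝ) (y : E2) (hy : ‖y‖ = R) :
    ∃ θ ∈ Set.Ico 0 (2 * Real.pi), y = circlePt R θ := by
  have hper : Function.Periodic (circlePt R) (2 * Real.pi) := circlePt_periodic R
  obtain ⟨θ, hθ, h⟩ := hper.exists_mem_Ico₀ Real.two_pi_pos (Complex.arg (toC y))
  refine ⟨θ, hθ, ?_⟩
  rw [← h]
  apply toC_inj
  rw [toC_circlePt, ← hy, ← toC_norm, Complex.norm_mul_exp_arg_mul_I]

lemma crossing (R : ℝ) (hR : 0 < R) (a1 b1 a2 b2 : ℝ) (h1 : a1 < b1) (h2 : b1 < a2)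
    (h3 : a2 < b2) (h4 : b2 < a1 + 2 * Real.pi) (S T : Set E2)
    (hf : JoinedIn (Metric.closedBall 0 R ∩ S) (circlePt R a1) (circlePt R a2))
    (hg : JoinedIn (Metric.closedBall 0 R ∩ T) (circlePt R b1) (circlePt R b2)) :
    ∃ z, z ∈ S ∧ z ∈ T := by
  obtain ⟨f, hf⟩ := hf
  obtain ⟨g, hg⟩ := hg
  have hf' : ∀ t, f.extend t ∈ Metric.closedBall 0 R ∩ S := fun t => hf _
  have hg' : ∀ t, g.extend t ∈ Metric.closedBall 0 R ∩ T := fun t => hg _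
  obtain ⟨s, t, hst⟩ := crossing_complex R hR a1 b1 a2 b2 h1 h2 h3 h4
    (fun t => toC (f.extend t)) (fun t => toC (g.extend t))
    (toC_cont.comp f.continuous_extend) (toC_cont.comp g.continuous_extend)
    (fun t => by rw [toC_norm]; simpa using (hf' t).1)
    (fun t => by rw [toC_norm]; simpa using (hg' t).1)
    (by simp [toC_circlePt]) (by simp [toC_circlePt]) (by simp [toC_circlePt])
    (by simp [toC_circlePt])
  have := toC_inj _ _ hst
  exact ⟨f.extend s, (hf' s).2, this ▸ (hg' t).2⟩

lemma first_exit (R : ℝ) (u : E2 → ℝ) (x : E2) (hx : ‖x‖ < R) (γ : ℝ → E2)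
    (hc : ContinuousOn γ (Set.Icc 0 1)) (h0 : γ 0 = x) (h1 : ‖γ 1 - x‖ = 2 * R)
    (hu : ∀ t ∈ Set.Icc (0:ℝ) 1, u (γ t) = u x) :
    ∃ τ ∈ Set.Icc (0:ℝ) 1, ‖γ τ‖ = R ∧
      JoinedIn (Metric.closedBall 0 R ∩ {y | u y = u x}) x (γ τ) := by
  have hcn : ContinuousOn (fun t => ‖γ t‖) (Set.Icc 0 1) := hc.norm
  have h1' : R ≤ ‖γ 1‖ := by
    have := norm_sub_le (γ 1) x
    linarith
  have hIVT : ∀ b ∈ Set.Icc (0:ℝ) 1, R ≤ ‖γ b‖ → ∃ t ∈ Set.Icc 0 b, ‖γ t‖ = R := by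
    intro b hb hRb
    obtain ⟨t, ht, h⟩ := intermediate_value_Icc hb.1
      (hcn.mono (Set.Icc_subset_Icc_right hb.2)) (show R ∈ _ from ⟨by simp [h0, hx.le], hRb⟩)
    exact ⟨t, ht, h⟩
  have hcomp : IsCompact (Set.Icc (0:ℝ) 1 ∩ (fun t => ‖γ t‖) ⁻¹' {R}) :=
    isCompact_Icc.of_isClosed_subset
      (hcn.preimage_isClosed_of_isClosed isClosed_Icc isClosed_singleton) Set.inter_subset_left
  obtain ⟨t1, ht1, ht1'⟩ := hIVT 1 (by simp) h1'
  obtain ⟨τ, ⟨hτ, hτR⟩, hleast⟩ := hcomp.exists_isLeast ⟨t1, ht1, ht1'⟩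
  have hτR' : ‖γ τ‖ = R := hτR
  have hle : ∀ t ∈ Set.Icc 0 τ, ‖γ t‖ ≤ R := by
    intro t ht
    by_contra! hlt
    have htI : t ∈ Set.Icc (0:ℝ) 1 := ⟨ht.1, ht.2.trans hτ.2⟩
    obtain ⟨s, hs, hsR⟩ := hIVT t htI hlt.le
    have h2 : τ ≤ s := hleast ⟨⟨hs.1, hs.2.trans htI.2⟩, hsR⟩
    have : t = τ := le_antisymm ht.2 (h2.trans hs.2)
    rw [this, hτR'] at hlt
    exact lt_irrefl _ hlt
  refine ⟨τ, hτ, hτR', ?_⟩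
  have hmem : ∀ s ∈ unitInterval, s * τ ∈ Set.Icc 0 τ := fun s hs =>
    ⟨mul_nonneg hs.1 hτ.1, mul_le_of_le_one_left hτ.1 hs.2⟩
  have hsub : Set.Icc 0 τ ⊆ Set.Icc (0:ℝ) 1 := Set.Icc_subset_Icc_right hτ.2
  refine JoinedIn.ofLine (f := fun s => γ (s * τ)) ?_ (by simp [h0]) (by simp) ?_
  · exact hc.comp (by fun_prop) fun s hs => hsub (hmem s hs)
  · rintro _ ⟨s, hs, rfl⟩
    exact ⟨by simpa using hle _ (hmem s hs), hu _ (hsub (hmem s hs))⟩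

theorem saddle_count_le_boundary_critical_count
    (R : ℝ) (hR : 0 < R) (u : EuclideanSpace ℝ (Fin 2) → ℝ)
    (hu : ContDiff ℝ 2 u)
    -- the set of critical points of the restriction of `u` to the boundary circle
    (bc : Set ℝ)
    (hbc : bc = {θ ∈ Set.Ico 0 (2 * Real.pi) |
      deriv (fun s => u (circlePt R s)) θ = 0})
    (hbcfin : bc.Finite)
    -- interior critical points are non-degenerate
    (hnondegInt : ∀ x : EuclideanSpace ℝ (Fin 2), ‖x‖ < R → fderiv ℝ u x = 0 →
      ∀ v : EuclideanSpace ℝ (Fin 2), v ≠ 0 →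
        ∃ w : EuclideanSpace ℝ (Fin 2), iteratedFDeriv ℝ 2 u x ![v, w] ≠ 0)
    -- boundary critical points are non-degenerate
    (hnondegBd : ∀ θ ∈ bc, deriv (deriv (fun s => u (circlePt R s))) θ ≠ 0)
    -- no point of the boundary stratum is critical for the two-dimensional stratum
    (hbdNotCrit : ∀ θ : ℝ, fderiv ℝ u (circlePt R θ) ≠ 0)
    -- distinct stratified critical points have distinct critical values
    (hdistinct : ∀ x y : EuclideanSpace ℝ (Fin 2),
      ((‖x‖ < R ∧ fderiv ℝ u x = 0) ∨ ∃ θ ∈ bc, x = circlePt R θ) →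
      ((‖y‖ < R ∧ fderiv ℝ u y = 0) ∨ ∃ θ ∈ bc, y = circlePt R θ) →
      x ≠ y → u x ≠ u y) :
    -- conclusion: the set of `2R`-saddle points in the closed ball is finite
    -- and has at most `max {0, N - 3}` elements
    {x : EuclideanSpace ℝ (Fin 2) | x ∈ Metric.closedBall 0 R ∧ fderiv ℝ u x = 0 ∧
      ∃ γ : Fin 4 → ℝ → EuclideanSpace ℝ (Fin 2),
        (∀ i, ContinuousOn (γ i) (Set.Icc 0 1)) ∧
        (∀ i, Set.InjOn (γ i) (Set.Icc 0 1)) ∧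
        (∀ i, γ i 0 = x) ∧ (∀ i, ‖γ i 1 - x‖ = 2 * R) ∧
        (∀ i j, i ≠ j → (γ i '' Set.Icc 0 1) ∩ (γ j '' Set.Icc 0 1) ⊆ {x}) ∧
        (∀ i, ∀ t ∈ Set.Icc (0:ℝ) 1, u (γ i t) = u x)}.Finite ∧
    {x : EuclideanSpace ℝ (Fin 2) | x ∈ Metric.closedBall 0 R ∧ fderiv ℝ u x = 0 ∧
      ∃ γ : Fin 4 → ℝ → EuclideanSpace ℝ (Fin 2),
        (∀ i, ContinuousOn (γ i) (Set.Icc 0 1)) ∧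
        (∀ i, Set.InjOn (γ i) (Set.Icc 0 1)) ∧
        (∀ i, γ i 0 = x) ∧ (∀ i, ‖γ i 1 - x‖ = 2 * R) ∧
        (∀ i j, i ≠ j → (γ i '' Set.Icc 0 1) ∩ (γ j '' Set.Icc 0 1) ⊆ {x}) ∧
        (∀ i, ∀ t ∈ Set.Icc (0:ℝ) 1, u (γ i t) = u x)}.ncard ≤ bc.ncard - 3 := by
  
  set S := {x : EuclideanSpace ℝ (Fin 2) | x ∈ Metric.closedBall 0 R ∧ fderiv ℝ u x = 0 ∧
      ∃ γ : Fin 4 → ℝ → EuclideanSpace ℝ (Fin 2),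
        (∀ i, ContinuousOn (γ i) (Set.Icc 0 1)) ∧
        (∀ i, Set.InjOn (γ i) (Set.Icc 0 1)) ∧
        (∀ i, γ i 0 = x) ∧ (∀ i, ‖γ i 1 - x‖ = 2 * R) ∧
        (∀ i j, i ≠ j → (γ i '' Set.Icc 0 1) ∩ (γ j '' Set.Icc 0 1) ⊆ {x}) ∧
        (∀ i, ∀ t ∈ Set.Icc (0:ℝ) 1, u (γ i t) = u x)} with hS
  have hint : ∀ x ∈ S, ‖x‖ < R := by
    rintro x ⟨hx, hfx, -⟩
    refine lt_of_le_of_ne (by simpa using hx) fun h => ?_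
    obtain ⟨θ, -, rfl⟩ := exists_angle R x h
    exact hbdNotCrit θ hfx
  have hstar : ∀ x : E2, ∃ p : Fin 4 → ℝ, StrictMono p ∧ (x ∈ S → ∀ i, p i ∈ Set.Ico 0 (2 * Real.pi) ∧
      JoinedIn (Metric.closedBall 0 R ∩ {y | u y = u x}) x (circlePt R (p i))) := by
    intro x
    by_cases hxS : x ∈ S
    swap
    · exact ⟨fun i => (i : ℕ), fun i j h => Nat.cast_lt.2 h, fun h => (hxS h).elim⟩
    have hxR := hint x hxS
    obtain ⟨-, -, γ, g1, -, g3, g4, g5, g6⟩ := hxS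
    choose τ hτ hτR hJ using fun i => first_exit R u x hxR (γ i) (g1 i) (g3 i) (g4 i) (g6 i)
    choose θ hθ hθe using fun i => exists_angle R (γ i (τ i)) (hτR i)
    have hinj : Function.Injective θ := by
      intro i j hij
      by_contra hne
      have e : γ i (τ i) = γ j (τ j) := by rw [hθe i, hθe j, hij]
      have : γ i (τ i) ∈ ({x} : Set E2) :=
        g5 i j hne ⟨⟨_, hτ i, rfl⟩, ⟨_, hτ j, e.symm⟩⟩
      have h2 := hτR i
      rw [this] at h2
      linarith
    have hcard : (Finset.univ.image θ).card = 4 := by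
      rw [Finset.card_image_of_injective _ hinj]; simp
    refine ⟨(Finset.univ.image θ).orderEmbOfFin hcard, OrderEmbedding.strictMono _, fun _ i => ?_⟩
    have hm := Finset.orderEmbOfFin_mem (Finset.univ.image θ) hcard i
    obtain ⟨j, -, hj⟩ := Finset.mem_image.1 hm
    rw [← hj]
    exact ⟨hθ j, hθe j ▸ hJ j⟩
  choose p hpm hp using hstar
  have huc : Continuous u := hu.continuous
  have hgc : Continuous (fun s => u (circlePt R s)) := huc.comp (circlePt_cont R)
  have hval : ∀ x ∈ S, ∀ i, u (circlePt R (p x i)) = u x := fun x hx i =>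
    (hp x hx i).2.target_mem.2
  have hne : ∀ x ∈ S, ∀ y ∈ S, x ≠ y → u x ≠ u y := fun x hx y hy hxy =>
    hdistinct x y (Or.inl ⟨hint x hx, hx.2.1⟩) (Or.inl ⟨hint y hy, hy.2.1⟩) hxy
  have hmemC : ∀ c, c ∈ hbcfin.toFinset ↔
      c ∈ Set.Ico 0 (2 * Real.pi) ∧ deriv (fun s => u (circlePt R s)) c = 0 := by
    intro c; rw [Set.Finite.mem_toFinset, hbc]; rfl
  have hin : ∀ x ∈ S, ∀ i j, p x i < p x j →
      ∃ c ∈ hbcfin.toFinset, p x i < c ∧ c < p x j := by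
    intro x hx i j hij
    obtain ⟨c, hc, hd⟩ := exists_deriv_eq_zero hij hgc.continuousOn
      (by simp only [hval x hx])
    exact ⟨c, (hmemC c).2 ⟨⟨(hp x hx i).1.1.trans hc.1.le, hc.2.trans (hp x hx j).1.2⟩, hd⟩, hc⟩
  have hout : ∀ x ∈ S, ∀ i j, p x i < p x j →
      ∃ c ∈ hbcfin.toFinset, c < p x i ∨ p x j < c := by
    intro x hx i j hij
    have hi := (hp x hx i).1
    have hj := (hp x hx j).1
    obtain ⟨c, hc, hd⟩ := exists_deriv_eq_zero (f := fun s => u (circlePt R s))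
      (show p x j < p x i + 2 * Real.pi by linarith [hi.1, hj.2]) hgc.continuousOn
      (by simp only [circlePt_periodic, hval x hx])
    by_cases hcl : c < 2 * Real.pi
    · exact ⟨c, (hmemC c).2 ⟨⟨hj.1.trans hc.1.le, hcl⟩, hd⟩, Or.inr hc.1⟩
    · refine ⟨c - 2 * Real.pi, (hmemC _).2 ⟨⟨by linarith, by linarith [hc.2, hi.2]⟩, ?_⟩,
        Or.inl (by linarith [hc.2])⟩
      have := deriv_comp_add_const (fun s => u (circlePt R s)) (2 * Real.pi) (c - 2 * Real.pi)
      simp only [circlePt_periodic, sub_add_cancel] at this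
      rw [this]; exact hd
  have hjoin : ∀ x ∈ S, ∀ i j, JoinedIn (Metric.closedBall 0 R ∩ {y | u y = u x})
      (circlePt R (p x i)) (circlePt R (p x j)) := fun x hx i j =>
    (hp x hx i).2.symm.trans (hp x hx j).2
  have main : ∀ K : Finset E2, (K : Set E2) ⊆ S → K.card ≤ bc.ncard - 3 := by
    intro K hK
    rw [Set.ncard_eq_toFinset_card _ hbcfin]
    rcases K.eq_empty_or_nonempty with rfl | ⟨x, hxK⟩
    · simp
    have hx := hK hxK
    have hcard2 : 2 ≤ hbcfin.toFinset.card := by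
      have hlt : p x 0 < p x 1 := hpm x (by decide)
      obtain ⟨c, hc, hc'⟩ := hin x hx 0 1 hlt
      obtain ⟨d, hd, hd'⟩ := hout x hx 0 1 hlt
      exact Finset.one_lt_card.2 ⟨c, hc, d, hd, by
        rintro rfl; rcases hd' with h | h <;> linarith [hc'.1, hc'.2]⟩
    have hKc : 0 < K.card := Finset.card_pos.2 ⟨x, hxK⟩
    classical
    have := comb p hpm K.card K hbcfin.toFinset rfl hcard2
      (by
        intro a ha b hb hab i j e
        apply hne a (hK ha) b (hK hb) hab
        rw [← hval a (hK ha) i, ← hval b (hK hb) j, e])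
      (by
        intro a ha b hb hab i i' j j' h1 h2 h3
        obtain ⟨z, hz1, hz2⟩ := crossing R hR _ _ _ _ h1 h2 h3
          (by linarith [(hp b (hK hb) j').1.2, (hp a (hK ha) i).1.1]) _ _
          (hjoin a (hK ha) i i') (hjoin b (hK hb) j j')
        exact hne a (hK ha) b (hK hb) hab (hz1.symm.trans hz2))
      (fun a ha => hin a (hK ha)) (fun a ha => hout a (hK ha))
    omega
  have hfin : S.Finite := by
    by_contra hinf
    obtain ⟨K, hK, hKc⟩ := Set.Infinite.exists_subset_card_eq hinf (bc.ncard - 3 + 1)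
    have := main K hK
    omega
  refine ⟨hfin, ?_⟩
  rw [Set.ncard_eq_toFinset_card _ hfin]
  exact main _ (by simp)
end
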